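/- arXiv:2012.15795 — 2 statements merged into one kernel-verified Lean document; each statement's English description precedes it below -/
import Mathlib

section
/- Let n ≥ 1, κ > 0, π ∈ F^B_κ(A^n), and 1 ≤ i ≤ n. Then: (a) ∏_{i≤j≤n} (∇π)([i,j]) = ∏_{i≤j≤n} (∇ι^B_A π)(n+2−i, j+1); (b) ∏_{1≤j≤i} (∇π)([j,i]) = ∏_{1≤j≤i} (∇ι^B_A π)(n+2−j, i+1); (c) 2 ∏_{i≤j≤n} (∇ Rvac^B_F π)([i,j]) = ∏_{i≤j≤n} (∇ι^B_A π)(n+1−j, i+1); (d) 2 ∏_{1≤j≤i} (∇ Rvac^B_F π)([j,i]) = ∏_{1≤j≤i} (∇ι^B_A π)(n+2−i, j). -/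
open scoped Classical

noncomputable section

/-- `P̂`: the poset `P` with a new minimum `0̂` and a new maximum `1̂` adjoined. -/
abbrev Phat (P : Type) := WithBot (WithTop P)

instance {P : Type} [Fintype P] : Fintype (Phat P) :=
  inferInstanceAs (Fintype (Option (Option P)))

/-- The inclusion of `P` into `P̂`. -/
def emb {P : Type} (p : P) : Phat P := ((p : WithTop P) : WithBot (WithTop P))

/-- The new maximum `1̂` of `P̂`. -/
def topHat (P : Type) : Phat P := ((⊤ : WithTop P) : WithBot (WithTop P))

variable {P : Type} [Fintype P] [PartialOrder P]

/-- `∑_{y ⋖ x} π(y)`. -/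
def covSumBelow (π : Phat P → ℝ) (x : Phat P) : ℝ :=
  ∑ y : Phat P, if y ⋖ x then π y else 0

/-- `∑_{x ⋖ y} 1/π(y)`. -/
def covSumAboveInv (π : Phat P → ℝ) (x : Phat P) : ℝ :=
  ∑ y : Phat P, if x ⋖ y then (π y)⁻¹ else 0

/-- The birational order-filter rank toggle `𝐭_i`, in simultaneous form (it agrees with the
composition of the pairwise commuting birational order filter toggles `t_p` over `p ∈ P_i`,
since a toggle `t_p` only changes the value at `p` and only reads values at `p` and at
elements covering or covered by `p`, which have different ranks). -/
def rankToggleB (rk : P → ℕ) (i : ℕ) (π : Phat P → ℝ) : Phat P → ℝ :=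
  fun x =>
    if ∃ p : P, rk p = i ∧ x = emb p then
      covSumBelow π x / (π x * covSumAboveInv π x)
    else π x

/-- Apply a word of rank toggles; the head of the list is applied last, matching the
convention that in a product `𝐭_{i_1} 𝐭_{i_2} ⋯ 𝐭_{i_k}` the rightmost factor acts first. -/
def applyB (rk : P → ℕ) : List ℕ → (Phat P → ℝ) → Phat P → ℝ
  | [] => fun π => π
  | i :: w => fun π => rankToggleB rk i (applyB rk w π)

/-- The word `𝐭_0 𝐭_1 ⋯ 𝐭_r` for rowmotion. -/
def rowWordB (r : ℕ) : List ℕ := List.range (r + 1)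

/-- The word `(𝐭_r)(𝐭_{r-1} 𝐭_r) ⋯ (𝐭_0 𝐭_1 ⋯ 𝐭_r)` for rowvacuation. -/
def rvacWordB (r : ℕ) : List ℕ :=
  (List.range (r + 1)).foldr (fun k acc => (List.range (r + 1)).drop (r - k) ++ acc) []

/-- The word `(𝐭_0)(𝐭_1 𝐭_0) ⋯ (𝐭_r 𝐭_{r-1} ⋯ 𝐭_0)` for dual rowvacuation. -/
def drvacWordB (r : ℕ) : List ℕ :=
  (List.range (r + 1)).foldr (fun k acc => (List.range (k + 1)).reverse ++ acc) []

/-- Birational order filter rowmotion `Row^B_F = 𝐭_0 𝐭_1 ⋯ 𝐭_r`. -/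
def RowB (rk : P → ℕ) (r : ℕ) : (Phat P → ℝ) → Phat P → ℝ := applyB rk (rowWordB r)

/-- The inverse of birational order filter rowmotion, `(Row^B_F)⁻¹ = 𝐭_r ⋯ 𝐭_1 𝐭_0`
(each toggle is an involution, so the reversed word gives the inverse map). -/
def RowInvB (rk : P → ℕ) (r : ℕ) : (Phat P → ℝ) → Phat P → ℝ := applyB rk (rowWordB r).reverse

/-- Birational order filter rowvacuation `Rvac^B_F`. -/
def RvacB (rk : P → ℕ) (r : ℕ) : (Phat P → ℝ) → Phat P → ℝ := applyB rk (rvacWordB r)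

/-- Birational order filter dual rowvacuation `DRvac^B_F`. -/
def DRvacB (rk : P → ℕ) (r : ℕ) : (Phat P → ℝ) → Phat P → ℝ := applyB rk (drvacWordB r)

end

noncomputable section

/-- The down-transfer `∇ : F^B_κ(P) → A^B_κ(P)`, `(∇π)(x) = π(x) / ∑_{y ⋖ x} π(y)`. -/
def downT {P : Type} [Fintype P] [PartialOrder P] (π : Phat P → ℝ) : P → ℝ :=
  fun x => π (emb x) / covSumBelow π (emb x)

end

/-- The underlying set of the poset `Aⁿ`: pairs `(i,j)` with `1 ≤ i ≤ j ≤ n`,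
representing the intervals `[i,j] ⊆ [n]`. -/
def AnP (n : ℕ) : Type := {p : ℕ × ℕ // 1 ≤ p.1 ∧ p.1 ≤ p.2 ∧ p.2 ≤ n}

/-- `Aⁿ` is ordered by containment of intervals. -/
instance (n : ℕ) : PartialOrder (AnP n) where
  le x y := y.val.1 ≤ x.val.1 ∧ x.val.2 ≤ y.val.2
  le_refl x := ⟨le_refl _, le_refl _⟩
  le_trans x y z h1 h2 := ⟨le_trans h2.1 h1.1, le_trans h1.2 h2.2⟩
  le_antisymm x y h1 h2 :=
    Subtype.ext (Prod.ext_iff.mpr ⟨le_antisymm h2.1 h1.1, le_antisymm h1.2 h2.2⟩)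

instance (n : ℕ) : Fintype (AnP n) :=
  Fintype.subtype
    ((Finset.Icc 1 n ×ˢ Finset.Icc 1 n).filter (fun p => 1 ≤ p.1 ∧ p.1 ≤ p.2 ∧ p.2 ≤ n))
    (by
      intro x
      simp only [Finset.mem_filter, Finset.mem_product, Finset.mem_Icc]
      omega)

/-- The rank function of `Aⁿ`: `rk [i,j] = j - i`; `Aⁿ` is graded of rank `n - 1`. -/
def rkAn (n : ℕ) : AnP n → ℕ := fun p => p.val.2 - p.val.1
noncomputable section

/-- The underlying set of the rectangle poset `rect(a,b)`:
pairs `(i,j)` with `1 ≤ i ≤ a`, `1 ≤ j ≤ b`. -/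
def RectP (a b : ℕ) : Type := {p : ℕ × ℕ // 1 ≤ p.1 ∧ p.1 ≤ a ∧ 1 ≤ p.2 ∧ p.2 ≤ b}

/-- `rect(a,b)` carries the componentwise order. -/
instance (a b : ℕ) : PartialOrder (RectP a b) where
  le x y := x.val.1 ≤ y.val.1 ∧ x.val.2 ≤ y.val.2
  le_refl x := ⟨le_refl _, le_refl _⟩
  le_trans x y z h1 h2 := ⟨le_trans h1.1 h2.1, le_trans h1.2 h2.2⟩
  le_antisymm x y h1 h2 :=
    Subtype.ext (Prod.ext_iff.mpr ⟨le_antisymm h1.1 h2.1, le_antisymm h1.2 h2.2⟩)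

instance (a b : ℕ) : Fintype (RectP a b) :=
  Fintype.subtype
    ((Finset.Icc 1 a ×ˢ Finset.Icc 1 b).filter (fun p => 1 ≤ p.1 ∧ p.1 ≤ a ∧ 1 ≤ p.2 ∧ p.2 ≤ b))
    (by
      intro x
      simp only [Finset.mem_filter, Finset.mem_product, Finset.mem_Icc]
      omega)

/-- The rank function of `rect(a,b)`: `rk (i,j) = i + j - 2`;
`rect(a,b)` is graded of rank `a + b - 2`. -/
def rkRect (a b : ℕ) : RectP a b → ℕ := fun p => p.val.1 + p.val.2 - 2

/-- The poset automorphism `Flip` of `Aⁿ`, `[i,j] ↦ [n+1-j, n+1-i]`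
(the reflection of `Aⁿ` across its vertical axis of symmetry). -/
def flipAn (n : ℕ) (p : AnP n) : AnP n :=
  ⟨(n + 1 - p.val.2, n + 1 - p.val.1), by
    have h := p.2
    show 1 ≤ n + 1 - p.val.2 ∧ n + 1 - p.val.2 ≤ n + 1 - p.val.1 ∧ n + 1 - p.val.1 ≤ n
    omega⟩

/-- `Flip` acting on labelings of `Âⁿ`: `(Flip π)(p) = π(Flip p)`, fixing `0̂` and `1̂`. -/
def flipLabelAn (n : ℕ) (π : Phat (AnP n) → ℝ) : Phat (AnP n) → ℝ :=
  fun x => if h : ∃ q : AnP n, x = emb q then π (emb (flipAn n h.choose)) else π x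

/-- The poset automorphism `Flip` of the square `rect(m,m)`: `(i,j) ↦ (j,i)`. -/
def flipRect (m : ℕ) (p : RectP m m) : RectP m m :=
  ⟨(p.val.2, p.val.1), ⟨p.2.2.2.1, p.2.2.2.2, p.2.1, p.2.2.1⟩⟩

/-- `Flip` acting on labelings of the square with `0̂`, `1̂` adjoined:
`(Flip π)(p) = π(Flip p)`, fixing `0̂` and `1̂`. -/
def flipLabelRect (m : ℕ) (π : Phat (RectP m m) → ℝ) : Phat (RectP m m) → ℝ :=
  fun x => if h : ∃ q : RectP m m, x = emb q then π (emb (flipRect m h.choose)) else π x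

/-- The value of the Grinberg–Roby embedding `ι^B_A` at an element `(i,j)` of
`rect(n+1,n+1)`: ranks `n+1,…,2n` (i.e. `i+j > n+2`) are filled with `4κ·π`, the middle
rank (`i+j = n+2`) with `2κ`, and ranks `0,…,n-1` (i.e. `i+j < n+2`) with
`κ/(Rvac^B_F π)`, suitably re-indexed. -/
def iotaVal (n : ℕ) (κ : ℝ) (π : Phat (AnP n) → ℝ) (q : RectP (n + 1) (n + 1)) : ℝ :=
  if h : n + 2 < q.val.1 + q.val.2 then
    4 * κ * π (emb (⟨(n + 2 - q.val.1, q.val.2 - 1), by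
      have hq := q.2
      show 1 ≤ n + 2 - q.val.1 ∧ n + 2 - q.val.1 ≤ q.val.2 - 1 ∧ q.val.2 - 1 ≤ n
      omega⟩ : AnP n))
  else if h2 : q.val.1 + q.val.2 = n + 2 then 2 * κ
  else
    κ / RvacB (rkAn n) (n - 1) π (emb (⟨(q.val.2, n + 1 - q.val.1), by
      have hq := q.2
      show 1 ≤ q.val.2 ∧ q.val.2 ≤ n + 1 - q.val.1 ∧ n + 1 - q.val.1 ≤ n
      omega⟩ : AnP n))

/-- The Grinberg–Roby embedding `ι^B_A : F^B_κ(Aⁿ) → F^B_{4κ²}(rect(n+1,n+1))`. -/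
def iotaAn (n : ℕ) (κ : ℝ) (π : Phat (AnP n) → ℝ) : Phat (RectP (n + 1) (n + 1)) → ℝ :=
  fun x =>
    if x = (⊥ : Phat (RectP (n + 1) (n + 1))) then 1
    else if x = topHat (RectP (n + 1) (n + 1)) then 4 * κ ^ 2
    else if h : ∃ q : RectP (n + 1) (n + 1), x = emb q then iotaVal n κ π h.choose
    else 0
end

theorem covSumBelow_emb {P : Type} [Fintype P] [PartialOrder P] (π : Phat P → ℝ) (x : P) :
    covSumBelow π (emb x) =
      (if IsMin x then π ⊥ else 0) + ∑ y : P, if y ⋖ x then π (emb y) else 0 := by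
  have h_top : ¬ topHat P ⋖ emb x := fun h =>
    absurd (WithBot.coe_lt_coe.1 h.lt) not_top_lt
  have h_bot : ((⊥ : Phat P) ⋖ emb x) ↔ IsMin x := by
    rw [emb, WithBot.bot_covBy_coe]
    constructor
    · intro h y hy
      exact WithTop.coe_le_coe.1 (h (WithTop.coe_le_coe.2 hy))
    · intro h y hy
      lift y to P using ne_top_of_le_ne_top WithTop.coe_ne_top hy
      exact WithTop.coe_le_coe.2 (h (WithTop.coe_le_coe.1 hy))
  have h_emb (y : P) : (emb y ⋖ emb x) ↔ y ⋖ x := by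
    rw [emb, emb, WithBot.coe_covBy_coe, WithTop.coe_covBy_coe]
  have h_sum : covSumBelow π (emb x) = (if (⊥ : Phat P) ⋖ emb x then π ⊥ else 0) +
      ((if topHat P ⋖ emb x then π (topHat P) else 0) +
        ∑ y : P, if emb y ⋖ emb x then π (emb y) else 0) := by
    rw [covSumBelow]
    exact (Fintype.sum_option (α := Option P) _).trans
      (congrArg _ (Fintype.sum_option (α := P) _))
  simp only [h_sum, h_top, h_bot, h_emb, if_false, zero_add]

theorem exists_covBy_emb {P : Type} [Fintype P] [PartialOrder P] (x : P) :
    ∃ y : Phat P, y ⋖ emb x := by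
  obtain ⟨y, -, hy⟩ := exists_le_covBy_of_lt (WithBot.bot_lt_coe (x : WithTop P))
  exact ⟨y, hy⟩

theorem exists_emb_covBy {P : Type} [Fintype P] [PartialOrder P] (x : P) :
    ∃ y : Phat P, emb x ⋖ y := by
  obtain ⟨y, hy, -⟩ := exists_covBy_le_of_lt
    (WithBot.coe_lt_coe.2 (WithTop.coe_lt_top x) : emb x < topHat P)
  exact ⟨y, hy⟩

theorem covSumBelow_emb_pos {P : Type} [Fintype P] [PartialOrder P] {π : Phat P → ℝ}
    (hπ : ∀ x, 0 < π x) (p : P) : 0 < covSumBelow π (emb p) := by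
  obtain ⟨y, hy⟩ := exists_covBy_emb p
  refine Finset.sum_pos' (fun z _ => ?_) ⟨y, Finset.mem_univ _, ?_⟩
  · split_ifs
    exacts [(hπ z).le, le_rfl]
  · rw [if_pos hy]
    exact hπ y

theorem covSumAboveInv_emb_pos {P : Type} [Fintype P] [PartialOrder P] {π : Phat P → ℝ}
    (hπ : ∀ x, 0 < π x) (p : P) : 0 < covSumAboveInv π (emb p) := by
  obtain ⟨y, hy⟩ := exists_emb_covBy p
  refine Finset.sum_pos' (fun z _ => ?_) ⟨y, Finset.mem_univ _, ?_⟩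
  · split_ifs
    exacts [(inv_pos.2 (hπ z)).le, le_rfl]
  · rw [if_pos hy]
    exact inv_pos.2 (hπ y)

theorem rankToggleB_pos {P : Type} [Fintype P] [PartialOrder P] (rk : P → ℕ) (i : ℕ)
    {π : Phat P → ℝ} (hπ : ∀ x, 0 < π x) (x : Phat P) : 0 < rankToggleB rk i π x := by
  rw [rankToggleB]
  split_ifs with h
  · obtain ⟨p, -, rfl⟩ := h
    exact div_pos (covSumBelow_emb_pos hπ p) (mul_pos (hπ _) (covSumAboveInv_emb_pos hπ p))
  · exact hπ x

theorem applyB_pos {P : Type} [Fintype P] [PartialOrder P] (rk : P → ℕ) (w : List ℕ)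
    {π : Phat P → ℝ} (hπ : ∀ x, 0 < π x) (x : Phat P) : 0 < applyB rk w π x := by
  induction w generalizing x with
  | nil => exact hπ x
  | cons i w ih => exact rankToggleB_pos rk i ih x

theorem applyB_bot {P : Type} [Fintype P] [PartialOrder P] (rk : P → ℕ) (w : List ℕ)
    (π : Phat P → ℝ) : applyB rk w π ⊥ = π ⊥ := by
  induction w with
  | nil => rfl
  | cons i w ih =>
    have h : ¬ ∃ p : P, rk p = i ∧ (⊥ : Phat P) = emb p := fun ⟨_, _, hp⟩ =>
      WithBot.bot_ne_coe hp
    exact (if_neg h).trans ih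

theorem sum_subtype_ite_val_eq {α : Type} (Q : α → Prop) [Fintype {a // Q a}]
    [DecidablePred Q] (f : {a // Q a} → ℝ) [DecidableEq α] (a : α) :
    (∑ y : {a // Q a}, if y.1 = a then f y else 0) = if h : Q a then f ⟨a, h⟩ else 0 := by
  split_ifs with h
  · simp_rw [← Subtype.ext_iff (a2 := (⟨a, h⟩ : {a // Q a}))]
    simp
  · exact Finset.sum_eq_zero fun y _ => if_neg fun (hy : y.1 = a) => h (hy ▸ y.2)

theorem sum_subtype_ite_val_eq_or {α : Type} (Q : α → Prop) [Fintype {a // Q a}]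
    [DecidablePred Q] (f : {a // Q a} → ℝ) [DecidableEq α] {a b : α} (hab : a ≠ b) :
    (∑ y : {a // Q a}, if y.1 = a ∨ y.1 = b then f y else 0) =
      (if h : Q a then f ⟨a, h⟩ else 0) + if h : Q b then f ⟨b, h⟩ else 0 := by
  rw [← sum_subtype_ite_val_eq, ← sum_subtype_ite_val_eq, ← Finset.sum_add_distrib]
  refine Finset.sum_congr rfl fun y _ => ?_
  by_cases h : y.1 = a
  · simp [h, hab]
  · simp [h]

noncomputable section

/-- The label of the interval `[i,j]`, extended by zero to all pairs of natural numbers. -/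
def labelAn (n : ℕ) (π : Phat (AnP n) → ℝ) (i j : ℕ) : ℝ :=
  if h : 1 ≤ i ∧ i ≤ j ∧ j ≤ n then π (emb (⟨(i, j), h⟩ : AnP n)) else 0

/-- The label of `(i,j)` in the rectangle, extended by zero to all pairs of natural numbers. -/
def labelRect (a b : ℕ) (π : Phat (RectP a b) → ℝ) (i j : ℕ) : ℝ :=
  if h : 1 ≤ i ∧ i ≤ a ∧ 1 ≤ j ∧ j ≤ b then π (emb (⟨(i, j), h⟩ : RectP a b)) else 0

end

theorem AnP_exists {n : ℕ} (i j : ℕ) (h : 1 ≤ i ∧ i ≤ j ∧ j ≤ n) :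
    ∃ x : AnP n, x.val = (i, j) :=
  ⟨⟨(i, j), h⟩, rfl⟩

theorem RectP_exists {a b : ℕ} (i j : ℕ) (h : 1 ≤ i ∧ i ≤ a ∧ 1 ≤ j ∧ j ≤ b) :
    ∃ x : RectP a b, x.val = (i, j) :=
  ⟨⟨(i, j), h⟩, rfl⟩

theorem AnP_le_iff {n : ℕ} (x y : AnP n) :
    x ≤ y ↔ y.val.1 ≤ x.val.1 ∧ x.val.2 ≤ y.val.2 := Iff.rfl

theorem RectP_le_iff {a b : ℕ} (x y : RectP a b) :
    x ≤ y ↔ x.val.1 ≤ y.val.1 ∧ x.val.2 ≤ y.val.2 := Iff.rfl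

theorem AnP_covBy_iff {n : ℕ} (y x : AnP n) :
    y ⋖ x ↔ y.val = (x.val.1 + 1, x.val.2) ∨ y.val = (x.val.1, x.val.2 - 1) := by
  have hx : 1 ≤ x.val.1 ∧ x.val.1 ≤ x.val.2 ∧ x.val.2 ≤ n := x.2
  have hy : 1 ≤ y.val.1 ∧ y.val.1 ≤ y.val.2 ∧ y.val.2 ≤ n := y.2
  simp only [Prod.ext_iff]
  constructor
  · intro h
    have hlt := h.lt
    rw [lt_iff_le_not_ge, AnP_le_iff, AnP_le_iff] at hlt
    by_cases hyx : y.val.1 = x.val.1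
    · obtain ⟨c, hc⟩ := AnP_exists (n := n) x.val.1 (x.val.2 - 1) (by omega)
      have := h.2 (c := c)
      simp only [lt_iff_le_not_ge, AnP_le_iff, hc] at this
      omega
    · obtain ⟨c, hc⟩ := AnP_exists (n := n) (x.val.1 + 1) x.val.2 (by omega)
      have := h.2 (c := c)
      simp only [lt_iff_le_not_ge, AnP_le_iff, hc] at this
      omega
  · intro h
    refine ⟨?_, fun c hc hc' => ?_⟩
    · rw [lt_iff_le_not_ge, AnP_le_iff, AnP_le_iff]
      omega
    · rw [lt_iff_le_not_ge, AnP_le_iff, AnP_le_iff] at hc hc'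
      omega

theorem RectP_covBy_iff {a b : ℕ} (y x : RectP a b) :
    y ⋖ x ↔ y.val = (x.val.1 - 1, x.val.2) ∨ y.val = (x.val.1, x.val.2 - 1) := by
  have hx : 1 ≤ x.val.1 ∧ x.val.1 ≤ a ∧ 1 ≤ x.val.2 ∧ x.val.2 ≤ b := x.2
  have hy : 1 ≤ y.val.1 ∧ y.val.1 ≤ a ∧ 1 ≤ y.val.2 ∧ y.val.2 ≤ b := y.2
  simp only [Prod.ext_iff]
  constructor
  · intro h
    have hlt := h.lt
    rw [lt_iff_le_not_ge, RectP_le_iff, RectP_le_iff] at hlt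
    by_cases hyx : y.val.1 = x.val.1
    · obtain ⟨c, hc⟩ := RectP_exists (a := a) (b := b) x.val.1 (x.val.2 - 1) (by omega)
      have := h.2 (c := c)
      simp only [lt_iff_le_not_ge, RectP_le_iff, hc] at this
      omega
    · obtain ⟨c, hc⟩ := RectP_exists (a := a) (b := b) (x.val.1 - 1) x.val.2 (by omega)
      have := h.2 (c := c)
      simp only [lt_iff_le_not_ge, RectP_le_iff, hc] at this
      omega
  · intro h
    refine ⟨?_, fun c hc hc' => ?_⟩
    · rw [lt_iff_le_not_ge, RectP_le_iff, RectP_le_iff]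
      omega
    · rw [lt_iff_le_not_ge, RectP_le_iff, RectP_le_iff] at hc hc'
      omega

theorem AnP_isMin_iff {n : ℕ} (x : AnP n) : IsMin x ↔ x.val.1 = x.val.2 := by
  have hx : 1 ≤ x.val.1 ∧ x.val.1 ≤ x.val.2 ∧ x.val.2 ≤ n := x.2
  constructor
  · intro h
    obtain ⟨c, hc⟩ := AnP_exists (n := n) x.val.2 x.val.2 (by omega)
    have := h (b := c)
    simp only [AnP_le_iff, hc] at this
    omega
  · intro h y hy
    have hy' : 1 ≤ y.val.1 ∧ y.val.1 ≤ y.val.2 ∧ y.val.2 ≤ n := y.2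
    rw [AnP_le_iff] at hy ⊢
    omega

theorem RectP_isMin_iff {a b : ℕ} (x : RectP a b) : IsMin x ↔ x.val.1 = 1 ∧ x.val.2 = 1 := by
  have hx : 1 ≤ x.val.1 ∧ x.val.1 ≤ a ∧ 1 ≤ x.val.2 ∧ x.val.2 ≤ b := x.2
  constructor
  · intro h
    obtain ⟨c, hc⟩ := RectP_exists (a := a) (b := b) 1 1 (by omega)
    have := h (b := c)
    simp only [RectP_le_iff, hc] at this
    omega
  · intro h y hy
    have hy' : 1 ≤ y.val.1 ∧ y.val.1 ≤ a ∧ 1 ≤ y.val.2 ∧ y.val.2 ≤ b := y.2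
    rw [RectP_le_iff] at hy ⊢
    omega

theorem apply_emb_An {n : ℕ} (π : Phat (AnP n) → ℝ) (x : AnP n) :
    π (emb x) = labelAn n π x.val.1 x.val.2 := by
  rw [labelAn, dif_pos x.2]
  rfl

theorem apply_emb_Rect {a b : ℕ} (π : Phat (RectP a b) → ℝ) (x : RectP a b) :
    π (emb x) = labelRect a b π x.val.1 x.val.2 := by
  rw [labelRect, dif_pos x.2]
  rfl

theorem sum_covBy_An {n : ℕ} (π : Phat (AnP n) → ℝ) (x : AnP n) :
    (∑ y : AnP n, if y ⋖ x then π (emb y) else 0) =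
      labelAn n π (x.val.1 + 1) x.val.2 + labelAn n π x.val.1 (x.val.2 - 1) := by
  simp only [AnP_covBy_iff]
  exact @sum_subtype_ite_val_eq_or _ (fun p : ℕ × ℕ => 1 ≤ p.1 ∧ p.1 ≤ p.2 ∧ p.2 ≤ n)
    (inferInstanceAs (Fintype (AnP n))) (fun _ => inferInstance)
    (fun y => π (emb (P := AnP n) y)) _
    (x.val.1 + 1, x.val.2) (x.val.1, x.val.2 - 1) (by simp)

theorem sum_covBy_Rect {a b : ℕ} (π : Phat (RectP a b) → ℝ) (x : RectP a b) :
    (∑ y : RectP a b, if y ⋖ x then π (emb y) else 0) =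
      labelRect a b π (x.val.1 - 1) x.val.2 + labelRect a b π x.val.1 (x.val.2 - 1) := by
  have hx : 1 ≤ x.val.1 := x.2.1
  simp only [RectP_covBy_iff]
  refine @sum_subtype_ite_val_eq_or _
    (fun p : ℕ × ℕ => 1 ≤ p.1 ∧ p.1 ≤ a ∧ 1 ≤ p.2 ∧ p.2 ≤ b)
    (inferInstanceAs (Fintype (RectP a b))) (fun _ => inferInstance)
    (fun y => π (emb (P := RectP a b) y)) _
    (x.val.1 - 1, x.val.2) (x.val.1, x.val.2 - 1) ?_
  simp only [ne_eq, Prod.mk.injEq]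
  omega

theorem downT_An {n : ℕ} (π : Phat (AnP n) → ℝ) (x : AnP n) :
    downT π x = labelAn n π x.val.1 x.val.2 / if x.val.1 = x.val.2 then π ⊥ else
      labelAn n π (x.val.1 + 1) x.val.2 + labelAn n π x.val.1 (x.val.2 - 1) := by
  have hx : 1 ≤ x.val.1 := x.2.1
  change π (emb x) / covSumBelow π (emb x) = _
  simp only [covSumBelow_emb, sum_covBy_An, AnP_isMin_iff]
  rw [apply_emb_An π x]
  split_ifs with h
  · have h₁ : labelAn n π (x.val.1 + 1) x.val.2 = 0 := dif_neg (by omega)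
    have h₂ : labelAn n π x.val.1 (x.val.2 - 1) = 0 := dif_neg (by omega)
    rw [h₁, h₂, add_zero, add_zero]
  · rw [zero_add]

theorem downT_An_mk {n : ℕ} (π : Phat (AnP n) → ℝ) (i j : ℕ) (h : 1 ≤ i ∧ i ≤ j ∧ j ≤ n) :
    downT π ⟨(i, j), h⟩ = labelAn n π i j /
      if i = j then π ⊥ else labelAn n π (i + 1) j + labelAn n π i (j - 1) :=
  downT_An π ⟨(i, j), h⟩

theorem downT_Rect {a b : ℕ} (π : Phat (RectP a b) → ℝ) (x : RectP a b)
    (hx : 2 < x.val.1 + x.val.2) :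
    downT π x = labelRect a b π x.val.1 x.val.2 /
      (labelRect a b π (x.val.1 - 1) x.val.2 + labelRect a b π x.val.1 (x.val.2 - 1)) := by
  have h_min : ¬ IsMin x := by
    rw [RectP_isMin_iff]
    omega
  change π (emb x) / covSumBelow π (emb x) = _
  rw [covSumBelow_emb, sum_covBy_Rect, apply_emb_Rect π x, if_neg h_min, zero_add]

theorem downT_Rect_mk {a b : ℕ} (π : Phat (RectP a b) → ℝ) (i j : ℕ)
    (h : 1 ≤ i ∧ i ≤ a ∧ 1 ≤ j ∧ j ≤ b) (hij : 2 < i + j) :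
    downT π ⟨(i, j), h⟩ = labelRect a b π i j /
      (labelRect a b π (i - 1) j + labelRect a b π i (j - 1)) :=
  downT_Rect π ⟨(i, j), h⟩ hij

theorem emb_injective {P : Type} : Function.Injective (emb : P → Phat P) := fun _ _ h =>
  WithTop.coe_injective (WithBot.coe_injective h)

theorem iotaAn_emb (n : ℕ) (κ : ℝ) (π : Phat (AnP n) → ℝ) (q : RectP (n + 1) (n + 1)) :
    iotaAn n κ π (emb q) = iotaVal n κ π q := by
  have h_bot : emb q ≠ ⊥ := WithBot.coe_ne_bot
  have h_top : emb q ≠ topHat _ := fun h => WithTop.coe_ne_top (WithBot.coe_injective h)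
  have h : ∃ q' : RectP (n + 1) (n + 1), emb q = emb q' := ⟨q, rfl⟩
  rw [iotaAn, if_neg h_bot, if_neg h_top, dif_pos h, ← emb_injective h.choose_spec]

theorem iotaVal_eq (n : ℕ) (κ : ℝ) (π : Phat (AnP n) → ℝ) (q : RectP (n + 1) (n + 1)) :
    iotaVal n κ π q = if n + 2 < q.val.1 + q.val.2 then
        4 * κ * labelAn n π (n + 2 - q.val.1) (q.val.2 - 1)
      else if q.val.1 + q.val.2 = n + 2 then 2 * κ
      else κ / labelAn n (RvacB (rkAn n) (n - 1) π) q.val.2 (n + 1 - q.val.1) := by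
  have hq : 1 ≤ q.val.1 ∧ q.val.1 ≤ n + 1 ∧ 1 ≤ q.val.2 ∧ q.val.2 ≤ n + 1 := q.2
  unfold iotaVal
  split_ifs with h₁ h₂
  · rw [labelAn, dif_pos (by omega)]
  · rfl
  · rw [labelAn, dif_pos (by omega)]

theorem labelRect_iotaAn (n : ℕ) (κ : ℝ) (π : Phat (AnP n) → ℝ) (i j : ℕ)
    (h : 1 ≤ i ∧ i ≤ n + 1 ∧ 1 ≤ j ∧ j ≤ n + 1) :
    labelRect (n + 1) (n + 1) (iotaAn n κ π) i j = if n + 2 < i + j then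
        4 * κ * labelAn n π (n + 2 - i) (j - 1)
      else if i + j = n + 2 then 2 * κ
      else κ / labelAn n (RvacB (rkAn n) (n - 1) π) j (n + 1 - i) := by
  rw [labelRect, dif_pos h]
  exact (iotaAn_emb n κ π ⟨(i, j), h⟩).trans (iotaVal_eq n κ π ⟨(i, j), h⟩)

theorem labelRect_iotaAn_of_gt (n : ℕ) (κ : ℝ) (π : Phat (AnP n) → ℝ) (i j : ℕ)
    (h : 1 ≤ i ∧ i ≤ n + 1 ∧ 1 ≤ j ∧ j ≤ n + 1) (hij : n + 2 < i + j) :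
    labelRect (n + 1) (n + 1) (iotaAn n κ π) i j =
      4 * κ * labelAn n π (n + 2 - i) (j - 1) := by
  rw [labelRect_iotaAn _ _ _ _ _ h, if_pos hij]

theorem labelRect_iotaAn_of_eq (n : ℕ) (κ : ℝ) (π : Phat (AnP n) → ℝ) (i j : ℕ)
    (h : 1 ≤ i ∧ i ≤ n + 1 ∧ 1 ≤ j ∧ j ≤ n + 1) (hij : i + j = n + 2) :
    labelRect (n + 1) (n + 1) (iotaAn n κ π) i j = 2 * κ := by
  rw [labelRect_iotaAn _ _ _ _ _ h, if_neg (by omega), if_pos hij]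

/-- Outside the square both sides vanish, by the junk value of division by zero. -/
theorem labelRect_iotaAn_of_lt (n : ℕ) (κ : ℝ) (π : Phat (AnP n) → ℝ) (i j : ℕ)
    (hij : i + j < n + 2) :
    labelRect (n + 1) (n + 1) (iotaAn n κ π) i j =
      κ / labelAn n (RvacB (rkAn n) (n - 1) π) j (n + 1 - i) := by
  by_cases h : 1 ≤ i ∧ i ≤ n + 1 ∧ 1 ≤ j ∧ j ≤ n + 1
  · rw [labelRect_iotaAn _ _ _ _ _ h, if_neg (by omega), if_neg (by omega)]
  · rw [labelRect, dif_neg h, labelAn, dif_neg (by omega), div_zero]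

theorem downT_iotaAn_upper (n : ℕ) {κ : ℝ} (hκ : 0 < κ) (π : Phat (AnP n) → ℝ) (h0 : π ⊥ = 1)
    (i j : ℕ) (h : 1 ≤ i ∧ i ≤ j ∧ j ≤ n)
    (h' : 1 ≤ n + 2 - i ∧ n + 2 - i ≤ n + 1 ∧ 1 ≤ j + 1 ∧ j + 1 ≤ n + 1) :
    downT (iotaAn n κ π) ⟨(n + 2 - i, j + 1), h'⟩ = downT π ⟨(i, j), h⟩ := by
  rw [downT_Rect_mk _ _ _ _ (by omega), downT_An_mk,
    labelRect_iotaAn_of_gt _ _ _ _ _ h' (by omega)]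
  have e₁ : n + 2 - (n + 2 - i) = i := by omega
  rw [e₁, Nat.add_sub_cancel]
  split_ifs with hij
  · rw [labelRect_iotaAn_of_eq _ _ _ _ _ (by omega) (by omega),
      labelRect_iotaAn_of_eq _ _ _ _ _ (by omega) (by omega), h0]
    field_simp
    ring
  · have e₂ : n + 2 - (n + 2 - i - 1) = i + 1 := by omega
    rw [labelRect_iotaAn_of_gt _ _ _ _ _ (by omega) (by omega),
      labelRect_iotaAn_of_gt _ _ _ _ _ (by omega) (by omega), e₁, e₂, Nat.add_sub_cancel,
      ← mul_add, mul_div_mul_left _ _ (by positivity)]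

/-- Here `[i,j]` with `i ≤ j + 1` is an interval of `Aⁿ` or the empty interval, the latter
corresponding to the middle rank of the square. -/
theorem downT_iotaAn_lower (n : ℕ) {κ : ℝ} (hκ : 0 < κ) (π : Phat (AnP n) → ℝ) (i j : ℕ)
    (hij : i ≤ j + 1) (hj : 1 < i ∨ j < n)
    (h : 1 ≤ n + 1 - j ∧ n + 1 - j ≤ n + 1 ∧ 1 ≤ i ∧ i ≤ n + 1) :
    downT (iotaAn n κ π) ⟨(n + 1 - j, i), h⟩ =
      (if i = j + 1 then 2 else (labelAn n (RvacB (rkAn n) (n - 1) π) i j)⁻¹) /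
        ((labelAn n (RvacB (rkAn n) (n - 1) π) i (j + 1))⁻¹ +
          (labelAn n (RvacB (rkAn n) (n - 1) π) (i - 1) j)⁻¹) := by
  have e₁ : n + 1 - (n + 1 - j) = j := by omega
  have e₂ : n + 1 - (n + 1 - j - 1) = j + 1 := by omega
  rw [downT_Rect_mk _ _ _ _ (by omega), labelRect_iotaAn_of_lt _ _ _ (n + 1 - j - 1) i (by omega),
    labelRect_iotaAn_of_lt _ _ _ (n + 1 - j) (i - 1) (by omega), e₁, e₂, div_eq_mul_inv κ,
    div_eq_mul_inv κ, ← mul_add]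
  split_ifs with h_mid
  · rw [labelRect_iotaAn_of_eq _ _ _ _ _ h (by omega), mul_comm 2 κ,
      mul_div_mul_left _ _ hκ.ne']
  · rw [labelRect_iotaAn_of_lt _ _ _ _ _ (by omega), e₁, div_eq_mul_inv κ,
      mul_div_mul_left _ _ hκ.ne']

theorem prod_Ico_mul_eq_of_telescope (F G u : ℕ → ℝ) {a b : ℕ} (hab : a ≤ b)
    (h : ∀ j, a ≤ j → j < b → F j * u (j + 1) = u j * G j) :
    (∏ j ∈ Finset.Ico a b, F j) * u b = u a * ∏ j ∈ Finset.Ico a b, G j := by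
  induction b, hab using Nat.le_induction with
  | base => simp
  | succ b hb ih =>
    have ih' := ih fun j hj hj' => h j hj (by omega)
    rw [Finset.prod_Ico_succ_top hb, Finset.prod_Ico_succ_top hb, mul_assoc,
      h b hb (by omega), ← mul_assoc, ih', mul_assoc]

/-- Let `n ≥ 1`, `κ > 0`, `π ∈ F^B_κ(Aⁿ)` and `1 ≤ i ≤ n`.  Then:
(a) `∏_{i≤j≤n} (∇π)([i,j]) = ∏_{i≤j≤n} (∇ι^B_A π)(n+2-i, j+1)`;
(b) `∏_{1≤j≤i} (∇π)([j,i]) = ∏_{1≤j≤i} (∇ι^B_A π)(n+2-j, i+1)`;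
(c) `2·∏_{i≤j≤n} (∇ Rvac^B_F π)([i,j]) = ∏_{i≤j≤n} (∇ι^B_A π)(n+1-j, i+1)`;
(d) `2·∏_{1≤j≤i} (∇ Rvac^B_F π)([j,i]) = ∏_{1≤j≤i} (∇ι^B_A π)(n+2-i, j)`. -/
theorem stmt14 (n : ℕ) (hn : 1 ≤ n) (κ : ℝ) (hκ : 0 < κ)
    (π : Phat (AnP n) → ℝ) (hpos : ∀ x, 0 < π x)
    (h0 : π ⊥ = 1) (h1 : π (topHat (AnP n)) = κ)
    (i : ℕ) (hi1 : 1 ≤ i) (hi2 : i ≤ n) :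
    ((∏ j ∈ Finset.Icc i n,
        (if h : 1 ≤ i ∧ i ≤ j ∧ j ≤ n then downT π ⟨(i, j), h⟩ else 1)) =
      ∏ j ∈ Finset.Icc i n,
        (if h : 1 ≤ n + 2 - i ∧ n + 2 - i ≤ n + 1 ∧ 1 ≤ j + 1 ∧ j + 1 ≤ n + 1 then
          downT (iotaAn n κ π) ⟨(n + 2 - i, j + 1), h⟩ else 1)) ∧
    ((∏ j ∈ Finset.Icc 1 i,
        (if h : 1 ≤ j ∧ j ≤ i ∧ i ≤ n then downT π ⟨(j, i), h⟩ else 1)) =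
      ∏ j ∈ Finset.Icc 1 i,
        (if h : 1 ≤ n + 2 - j ∧ n + 2 - j ≤ n + 1 ∧ 1 ≤ i + 1 ∧ i + 1 ≤ n + 1 then
          downT (iotaAn n κ π) ⟨(n + 2 - j, i + 1), h⟩ else 1)) ∧
    (2 * (∏ j ∈ Finset.Icc i n,
        (if h : 1 ≤ i ∧ i ≤ j ∧ j ≤ n then
          downT (RvacB (rkAn n) (n - 1) π) ⟨(i, j), h⟩ else 1)) =
      ∏ j ∈ Finset.Icc i n,
        (if h : 1 ≤ n + 1 - j ∧ n + 1 - j ≤ n + 1 ∧ 1 ≤ i + 1 ∧ i + 1 ≤ n + 1 then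
          downT (iotaAn n κ π) ⟨(n + 1 - j, i + 1), h⟩ else 1)) ∧
    (2 * (∏ j ∈ Finset.Icc 1 i,
        (if h : 1 ≤ j ∧ j ≤ i ∧ i ≤ n then
          downT (RvacB (rkAn n) (n - 1) π) ⟨(j, i), h⟩ else 1)) =
      ∏ j ∈ Finset.Icc 1 i,
        (if h : 1 ≤ n + 2 - i ∧ n + 2 - i ≤ n + 1 ∧ 1 ≤ j ∧ j ≤ n + 1 then
          downT (iotaAn n κ π) ⟨(n + 2 - i, j), h⟩ else 1)) := by
  have h_pos_rvac := applyB_pos (rkAn n) (rvacWordB (n - 1)) hpos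
  have h_bot_rvac : RvacB (rkAn n) (n - 1) π ⊥ = 1 := (applyB_bot _ _ π).trans h0
  set R := RvacB (rkAn n) (n - 1) π with hR
  set r := labelAn n R with hr
  have r_pos (a b : ℕ) (h : 1 ≤ a ∧ a ≤ b ∧ b ≤ n) : 0 < r a b := by
    rw [hr, labelAn, dif_pos h]
    exact h_pos_rvac _
  have r_zero (a b : ℕ) (h : ¬ (1 ≤ a ∧ a ≤ b ∧ b ≤ n)) : r a b = 0 := dif_neg h
  refine ⟨?_, ?_, ?_, ?_⟩
  · refine Finset.prod_congr rfl fun j hj => ?_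
    rw [Finset.mem_Icc] at hj
    rw [dif_pos (by omega), dif_pos (by omega),
      downT_iotaAn_upper n hκ π h0 i j (by omega)]
  · refine Finset.prod_congr rfl fun j hj => ?_
    rw [Finset.mem_Icc] at hj
    rw [dif_pos (by omega), dif_pos (by omega),
      downT_iotaAn_upper n hκ π h0 j i (by omega)]
  · have h_tele := prod_Ico_mul_eq_of_telescope
      (fun j => if h : 1 ≤ n + 1 - j ∧ n + 1 - j ≤ n + 1 ∧ 1 ≤ i + 1 ∧ i + 1 ≤ n + 1 then
          downT (iotaAn n κ π) ⟨(n + 1 - j, i + 1), h⟩ else 1)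
      (fun j => if h : 1 ≤ i ∧ i ≤ j ∧ j ≤ n then downT R ⟨(i, j), h⟩ else 1)
      (fun j => if j = i then 2 else if j = n + 1 then 1 else
        (r (i + 1) j + r i (j - 1)) / r (i + 1) j) (show i ≤ n + 1 by omega) ?_
    · simp only [if_true, if_neg (show n + 1 ≠ i by omega), mul_one] at h_tele
      exact h_tele.symm
    · intro j hij hjn
      have p₀ := r_pos i j (by omega)
      rw [dif_pos (by omega), dif_pos (by omega), downT_An_mk, h_bot_rvac,
        downT_iotaAn_lower n hκ π _ _ (by omega) (by omega), ← hR, ← hr,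
        if_neg (show j + 1 ≠ i by omega), Nat.add_sub_cancel, Nat.add_sub_cancel]
      rcases hij.eq_or_lt with rfl | hij
      · rw [if_pos rfl, if_pos rfl, if_pos rfl]
        split_ifs with hn'
        · rw [r_zero (i + 1) (i + 1) (by omega)]
          simp
        · have p₁ := r_pos (i + 1) (i + 1) (by omega)
          field_simp
          ring
      · have p₂ := r_pos (i + 1) j (by omega)
        have p₃ := r_pos i (j - 1) (by omega)
        rw [if_neg (show i + 1 ≠ j + 1 by omega), if_neg (show j ≠ i by omega),
          if_neg (show j ≠ n + 1 by omega), if_neg (show i ≠ j by omega)]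
        split_ifs with hn'
        · rw [r_zero (i + 1) (j + 1) (by omega)]
          simp only [inv_zero, zero_add]
          field_simp
        · have p₁ := r_pos (i + 1) (j + 1) (by omega)
          field_simp
          ring
  · have h_tele := prod_Ico_mul_eq_of_telescope
      (fun j => if h : 1 ≤ j ∧ j ≤ i ∧ i ≤ n then downT R ⟨(j, i), h⟩ else 1)
      (fun j => if h : 1 ≤ n + 2 - i ∧ n + 2 - i ≤ n + 1 ∧ 1 ≤ j ∧ j ≤ n + 1 then
          downT (iotaAn n κ π) ⟨(n + 2 - i, j), h⟩ else 1)
      (fun j => if j = i + 1 then 2 else if j = 1 then 1 else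
        (r j i + r (j - 1) (i - 1)) / r (j - 1) (i - 1)) (show 1 ≤ i + 1 by omega) ?_
    · simp only [if_true, if_neg (show 1 ≠ i + 1 by omega), one_mul] at h_tele
      rw [mul_comm]
      exact h_tele
    · intro j hj hji
      have p₀ := r_pos j i (by omega)
      obtain ⟨i, rfl⟩ : ∃ k, i = k + 1 := ⟨i - 1, by omega⟩
      have h_lower := downT_iotaAn_lower n hκ π j i (by omega) (by omega) (by omega)
      simp only [show n + 2 - (i + 1) = n + 1 - i by omega]
      rw [dif_pos (by omega), dif_pos (by omega), downT_An_mk, h_bot_rvac, h_lower, ← hR, ← hr,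
        if_neg (show j + 1 ≠ 1 by omega), if_neg (show j ≠ i + 1 + 1 by omega),
        Nat.add_sub_cancel, Nat.add_sub_cancel]
      rcases (show j ≤ i + 1 by omega).eq_or_lt with rfl | hji
      · rw [if_pos rfl, if_pos rfl, if_pos rfl]
        split_ifs with hn'
        · rw [r_zero (i + 1 - 1) i (by omega)]
          simp [mul_comm]
        · have p₁ := r_pos (i + 1 - 1) i (by omega)
          field_simp
          ring
      · have p₂ := r_pos (j + 1) (i + 1) (by omega)
        have p₃ := r_pos j i (by omega)
        rw [if_neg (show j + 1 ≠ i + 1 + 1 by omega), if_neg (show j ≠ i + 1 by omega), if_neg (show j ≠ i + 1 by omega)]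
        split_ifs with hn'
        · rw [r_zero (j - 1) i (by omega)]
          simp only [inv_zero, add_zero]
          field_simp
        · have p₁ := r_pos (j - 1) i (by omega)
          field_simp
          ring
end

section
/- For every n ≥ 1, κ > 0, and 1 ≤ i ≤ n, the statistic h^B_i is multiplicatively κ-mesic with respect to birational antichain rowmotion of A^n: for every π : A^n → R>0 and every m ≥ 1 with (Row^B_A)^m(π) = π, one has ∏_{k=0}^{m−1} h^B_i((Row^B_A)^k π) = κ^m. -/
open scoped Classical

noncomputable section

variable {P : Type} [Fintype P] [PartialOrder P]

/-- The sum, over all maximal chains `C` of `P` containing `p`, of `∏_{y ∈ C} π(y)`. -/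
def chainSum (π : P → ℝ) (p : P) : ℝ :=
  ∑ C ∈ Finset.univ.filter
      (fun C : Finset P => IsMaxChain (· ≤ ·) (C : Set P) ∧ p ∈ C),
    ∏ y ∈ C, π y

/-- The birational antichain rank toggle `𝛕_i`, in simultaneous form (it agrees with the
composition of the pairwise commuting birational antichain toggles `τ_p` over `p ∈ P_i`,
since in a graded poset no maximal chain contains two distinct elements of the same rank). -/
def arankToggleB (κ : ℝ) (rk : P → ℕ) (i : ℕ) (π : P → ℝ) : P → ℝ :=
  fun x => if rk x = i then κ / chainSum π x else π x

/-- Apply a word of antichain rank toggles; the head of the list is applied last. -/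
def aApplyB (κ : ℝ) (rk : P → ℕ) : List ℕ → (P → ℝ) → P → ℝ
  | [] => fun π => π
  | i :: w => fun π => arankToggleB κ rk i (aApplyB κ rk w π)

/-- The word `𝛕_r 𝛕_{r-1} ⋯ 𝛕_0` for antichain rowmotion. -/
def arowWordB (r : ℕ) : List ℕ := (List.range (r + 1)).reverse

/-- The word `(𝛕_r)(𝛕_r 𝛕_{r-1}) ⋯ (𝛕_r 𝛕_{r-1} ⋯ 𝛕_1 𝛕_0)` for antichain rowvacuation. -/
def arvacWordB (r : ℕ) : List ℕ :=
  (List.range (r + 1)).foldr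
    (fun k acc => (List.range (r + 1)).reverse.take (k + 1) ++ acc) []

/-- Birational antichain rowmotion `Row^B_A = 𝛕_r 𝛕_{r-1} ⋯ 𝛕_0`. -/
def RowAB (κ : ℝ) (rk : P → ℕ) (r : ℕ) : (P → ℝ) → P → ℝ := aApplyB κ rk (arowWordB r)

/-- Birational antichain rowvacuation `Rvac^B_A`. -/
def RvacAB (κ : ℝ) (rk : P → ℕ) (r : ℕ) : (P → ℝ) → P → ℝ := aApplyB κ rk (arvacWordB r)

end

noncomputable section

/-- The statistic `h^B_i(π) = ∏_{j=i}^n π([i,j]) · ∏_{j=1}^i π([j,i])`. -/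
def hB (n i : ℕ) (π : AnP n → ℝ) : ℝ :=
  (∏ p ∈ Finset.univ.filter (fun p : AnP n => p.val.1 = i), π p) *
  (∏ p ∈ Finset.univ.filter (fun p : AnP n => p.val.2 = i), π p)

end

noncomputable section

/-- The finite chains contained in `S` that are maximal among the chains contained in `S`. -/
def maxChainsIn {P : Type} [Fintype P] [PartialOrder P] (S : Set P) : Finset (Finset P) :=
  Finset.univ.filter fun C => (∀ x ∈ C, x ∈ S) ∧ (∀ x ∈ C, ∀ y ∈ C, x ≤ y ∨ y ≤ x) ∧
    ∀ x ∈ S, (∀ c ∈ C, x ≤ c ∨ c ≤ x) → x ∈ C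

/-- The sum of `∏_{y ∈ C} π(y)` over the maximal chains `C` of `S`. -/
def chainWeight {P : Type} [Fintype P] [PartialOrder P] (π : P → ℝ) (S : Set P) : ℝ :=
  ∑ C ∈ maxChainsIn S, ∏ y ∈ C, π y

end

section ChainWeight

variable {P : Type} [Fintype P] [PartialOrder P]

theorem mem_maxChainsIn {S : Set P} {C : Finset P} :
    C ∈ maxChainsIn S ↔ (∀ x ∈ C, x ∈ S) ∧ (∀ x ∈ C, ∀ y ∈ C, x ≤ y ∨ y ≤ x) ∧
      ∀ x ∈ S, (∀ c ∈ C, x ≤ c ∨ c ≤ x) → x ∈ C := by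
  simp [maxChainsIn]

theorem maxChainsIn_nonempty (S : Set P) : (maxChainsIn S).Nonempty := by
  let K : Finset (Finset P) := Finset.univ.filter fun C =>
    (∀ x ∈ C, x ∈ S) ∧ ∀ x ∈ C, ∀ y ∈ C, x ≤ y ∨ y ≤ x
  have hK : K.Nonempty := ⟨∅, by simp [K]⟩
  obtain ⟨C, hC⟩ := K.exists_maximal hK
  have hCK := hC.prop
  simp only [K, Finset.mem_filter, Finset.mem_univ, true_and] at hCK
  refine ⟨C, mem_maxChainsIn.2 ⟨hCK.1, hCK.2, fun x hx hxC => ?_⟩⟩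
  have hins : insert x C ∈ K := by
    simp only [K, Finset.mem_filter, Finset.mem_univ, true_and, Finset.mem_insert]
    grind
  exact hC.le_of_ge hins (Finset.subset_insert x C) (Finset.mem_insert_self x C)

theorem chainWeight_pos {π : P → ℝ} (hπ : ∀ p, 0 < π p) (S : Set P) : 0 < chainWeight π S :=
  Finset.sum_pos (fun _ _ => Finset.prod_pos fun y _ => hπ y) (maxChainsIn_nonempty S)

theorem chainWeight_congr {π σ : P → ℝ} {S : Set P} (h : ∀ p ∈ S, π p = σ p) :
    chainWeight π S = chainWeight σ S :=
  Finset.sum_congr rfl fun _ hC =>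
    Finset.prod_congr rfl fun y hy => h y ((mem_maxChainsIn.1 hC).1 y hy)

theorem chainWeight_empty (π : P → ℝ) : chainWeight π ∅ = 1 := by
  have h : maxChainsIn (∅ : Set P) = {∅} := by
    ext C
    simp only [mem_maxChainsIn, Finset.mem_singleton, Finset.eq_empty_iff_forall_notMem]
    constructor
    · exact fun hC => by simpa using hC.1
    · intro hC
      simp [hC]
  simp [chainWeight, h]

omit [Fintype P] in
theorem insert_filter_lt_union_filter_gt {C : Finset P} {p : P} (hp : p ∈ C)
    (hC : ∀ x ∈ C, x ≤ p ∨ p ≤ x) :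
    insert p (C.filter (fun x => x < p) ∪ C.filter (fun x => p < x)) = C := by
  ext x
  simp only [Finset.mem_insert, Finset.mem_union, Finset.mem_filter]
  have h : x ∈ C → x < p ∨ x = p ∨ p < x := fun hx =>
    (hC x hx).elim (fun h => h.lt_or_eq.imp_right Or.inl)
      fun h => Or.inr (h.lt_or_eq.symm.imp_left Eq.symm)
  grind

/-- A maximal chain of `S` through `p` splits at `p`. -/
theorem sum_maxChainsIn_mem (π : P → ℝ) {S : Set P} {p : P} (hp : p ∈ S) :
    ∑ C ∈ (maxChainsIn S).filter (fun C => p ∈ C), ∏ y ∈ C, π y =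
      π p * (chainWeight π (S ∩ Set.Iio p) * chainWeight π (S ∩ Set.Ioi p)) := by
  unfold chainWeight
  rw [Finset.sum_mul_sum, ← Finset.sum_product', Finset.mul_sum]
  refine Finset.sum_bij'
    (fun C _ => (C.filter (fun x => x < p), C.filter (fun x => p < x)))
    (fun D _ => insert p (D.1 ∪ D.2)) ?_ ?_ ?_ ?_ ?_
  · intro C hC
    simp only [Finset.mem_filter, mem_maxChainsIn] at hC
    obtain ⟨⟨hS, hch, hmax⟩, hpC⟩ := hC
    simp only [Finset.mem_product, mem_maxChainsIn, Finset.mem_filter, Set.mem_inter_iff,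
      Set.mem_Iio, Set.mem_Ioi]
    refine ⟨⟨by grind, by grind, ?_⟩, ⟨by grind, by grind, ?_⟩⟩
    · rintro x ⟨hxS, hxp⟩ hx
      refine ⟨hmax x hxS fun c hc => ?_, hxp⟩
      rcases hch c hc p hpC with h | h
      · rcases h.lt_or_eq with h | h
        · exact hx c ⟨hc, h⟩
        · exact Or.inl (h ▸ hxp.le)
      · exact Or.inl (hxp.le.trans h)
    · rintro x ⟨hxS, hxp⟩ hx
      refine ⟨hmax x hxS fun c hc => ?_, hxp⟩
      rcases hch p hpC c hc with h | h
      · rcases h.lt_or_eq with h | h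
        · exact hx c ⟨hc, h⟩
        · exact Or.inr (h ▸ hxp.le)
      · exact Or.inr (h.trans hxp.le)
  · rintro ⟨A, B⟩ hD
    simp only [Finset.mem_product, mem_maxChainsIn, Set.mem_inter_iff,
      Set.mem_Iio, Set.mem_Ioi] at hD
    obtain ⟨⟨hAS, hAch, hAmax⟩, ⟨hBS, hBch, hBmax⟩⟩ := hD
    simp only [Finset.mem_filter, mem_maxChainsIn, Finset.mem_insert, Finset.mem_union]
    refine ⟨⟨by grind, ?_, ?_⟩, by simp⟩
    · have hA : ∀ x ∈ A, x ≤ p := fun x hx => (hAS x hx).2.le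
      have hB : ∀ x ∈ B, p ≤ x := fun x hx => (hBS x hx).2.le
      have hAB : ∀ x ∈ A, ∀ y ∈ B, x ≤ y := fun x hx y hy => (hA x hx).trans (hB y hy)
      rintro x (rfl | hx | hx) y (rfl | hy | hy) <;> grind
    · intro x hxS hx
      rcases hx p (Or.inl rfl) with h | h
      · rcases h.lt_or_eq with h | h
        · exact Or.inr (Or.inl (hAmax x ⟨hxS, h⟩ fun c hc => hx c (Or.inr (Or.inl hc))))
        · exact Or.inl h
      · rcases h.lt_or_eq with h | h
        · exact Or.inr (Or.inr (hBmax x ⟨hxS, h⟩ fun c hc => hx c (Or.inr (Or.inr hc))))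
        · exact Or.inl h.symm
  · intro C hC
    simp only [Finset.mem_filter, mem_maxChainsIn] at hC
    obtain ⟨⟨hS, hch, hmax⟩, hpC⟩ := hC
    exact insert_filter_lt_union_filter_gt hpC fun x hx => hch x hx p hpC
  · rintro ⟨A, B⟩ hD
    simp only [Finset.mem_product, mem_maxChainsIn, Set.mem_inter_iff,
      Set.mem_Iio, Set.mem_Ioi] at hD
    obtain ⟨⟨hAS, -, -⟩, ⟨hBS, -, -⟩⟩ := hD
    have hA : ∀ x ∈ A, x < p := fun x hx => (hAS x hx).2
    have hB : ∀ x ∈ B, p < x := fun x hx => (hBS x hx).2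
    have hA' : ∀ x ∈ A, ¬ p < x := fun x hx => (hA x hx).asymm
    have hB' : ∀ x ∈ B, ¬ x < p := fun x hx => (hB x hx).asymm
    ext x <;> simp only [Finset.mem_insert, Finset.mem_union, Finset.mem_filter]
    · have := lt_irrefl p
      grind
    · have := lt_irrefl p
      grind
  · intro C hC
    simp only [Finset.mem_filter, mem_maxChainsIn] at hC
    obtain ⟨⟨hS, hch, hmax⟩, hpC⟩ := hC
    have hdisj : Disjoint (C.filter (fun x => x < p)) (C.filter (fun x => p < x)) :=
      Finset.disjoint_filter.2 fun x _ h => h.asymm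
    conv_lhs => rw [← insert_filter_lt_union_filter_gt hpC fun x hx => hch x hx p hpC]
    rw [Finset.prod_insert (by simp), Finset.prod_union hdisj]

theorem chainSum_eq_mul (π : P → ℝ) (p : P) :
    chainSum π p = π p * (chainWeight π (Set.Iio p) * chainWeight π (Set.Ioi p)) := by
  have h := sum_maxChainsIn_mem π (Set.mem_univ p)
  rw [Set.univ_inter, Set.univ_inter] at h
  rw [← h, chainSum]
  refine Finset.sum_congr ?_ fun _ _ => rfl
  ext C
  simp only [Finset.mem_filter, Finset.mem_univ, true_and, mem_maxChainsIn, Set.mem_univ,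
    implies_true, forall_const]
  refine and_congr_left fun _ => ⟨fun hC => ⟨?_, fun x hx => ?_⟩, fun hC => ⟨?_, ?_⟩⟩
  · exact fun x hx y hy => hC.1.total hx hy
  · have hins : IsChain (· ≤ ·) (insert x (C : Set P)) :=
      hC.1.insert fun b hb _ => hx b hb
    have := hC.2 hins (Set.subset_insert x _)
    have hx' : x ∈ (C : Set P) := this ▸ Set.mem_insert x _
    exact hx'
  · exact fun x hx y hy _ => hC.1 x hx y hy
  · intro t ht hCt
    refine hCt.antisymm fun x hx => hC.2 x fun c hc => ht.total hx (hCt hc)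

/-- If every maximal chain of `S` meets `T ⊆ S` exactly once, the weight of `S` splits along `T`. -/
theorem chainWeight_eq_sum (π : P → ℝ) {S : Set P} {T : Finset P} (hTS : ∀ y ∈ T, y ∈ S)
    (hT : ∀ C ∈ maxChainsIn S, ∃! y, y ∈ T ∧ y ∈ C) :
    chainWeight π S = ∑ y ∈ T,
      π y * (chainWeight π (S ∩ Set.Iio y) * chainWeight π (S ∩ Set.Ioi y)) := by
  rw [← Finset.sum_congr rfl fun y hy => sum_maxChainsIn_mem π (hTS y hy)]
  simp_rw [Finset.sum_filter]
  rw [Finset.sum_comm]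
  refine Finset.sum_congr rfl fun C hC => ?_
  obtain ⟨y, ⟨hyT, hyC⟩, hy⟩ := hT C hC
  rw [Finset.sum_eq_single_of_mem y hyT, if_pos hyC]
  exact fun z hz hzy => if_neg fun hzC => hzy (hy z ⟨hz, hzC⟩)

theorem chainWeight_Iio (π : P → ℝ) {p : P} (hp : (Set.Iio p).Nonempty) :
    chainWeight π (Set.Iio p) =
      ∑ y ∈ Finset.univ.filter (fun y => y ⋖ p), π y * chainWeight π (Set.Iio y) := by
  rw [chainWeight_eq_sum π (T := Finset.univ.filter fun y => y ⋖ p)]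
  · refine Finset.sum_congr rfl fun y hy => ?_
    replace hy : y ⋖ p := by simpa using hy
    have h1 : Set.Iio p ∩ Set.Iio y = Set.Iio y :=
      Set.inter_eq_right.2 (Set.Iio_subset_Iio hy.le)
    have h2 : Set.Iio p ∩ Set.Ioi y = ∅ := by
      rw [Set.inter_comm, Set.Ioi_inter_Iio]
      exact hy.Ioo_eq
    rw [h1, h2, chainWeight_empty, mul_one]
  · intro y hy
    replace hy : y ⋖ p := by simpa using hy
    exact hy.lt
  · intro C hC
    obtain ⟨hS, hch, hmax⟩ := mem_maxChainsIn.1 hC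
    have hne : C.Nonempty := by
      by_contra hne
      rw [Finset.not_nonempty_iff_eq_empty] at hne
      obtain ⟨x, hx⟩ := hp
      have := hmax x hx
      simp [hne] at this
    obtain ⟨y, hy⟩ := C.exists_maximal hne
    have htop : ∀ c ∈ C, c ≤ y := fun c hc =>
      (hch c hc y hy.prop).elim id fun h => hy.le_of_ge hc h
    refine ⟨y, ⟨?_, hy.prop⟩, ?_⟩
    · simp only [Finset.mem_filter, Finset.mem_univ, true_and]
      refine ⟨hS y hy.prop, fun z hyz hzp => ?_⟩
      exact hyz.not_ge (htop z (hmax z hzp fun c hc => Or.inr ((htop c hc).trans hyz.le)))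
    · rintro z ⟨hz, hzC⟩
      replace hz : z ⋖ p := by simpa using hz
      exact ((htop z hzC).lt_or_eq.resolve_left fun h => hz.2 h (hS y hy.prop))

theorem chainWeight_Ioi (π : P → ℝ) {p : P} (hp : (Set.Ioi p).Nonempty) :
    chainWeight π (Set.Ioi p) =
      ∑ y ∈ Finset.univ.filter (fun y => p ⋖ y), π y * chainWeight π (Set.Ioi y) := by
  rw [chainWeight_eq_sum π (T := Finset.univ.filter fun y => p ⋖ y)]
  · refine Finset.sum_congr rfl fun y hy => ?_
    replace hy : p ⋖ y := by simpa using hy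
    have h1 : Set.Ioi p ∩ Set.Ioi y = Set.Ioi y :=
      Set.inter_eq_right.2 (Set.Ioi_subset_Ioi hy.le)
    have h2 : Set.Ioi p ∩ Set.Iio y = ∅ := by
      rw [Set.Ioi_inter_Iio]
      exact hy.Ioo_eq
    rw [h1, h2, chainWeight_empty, one_mul]
  · intro y hy
    replace hy : p ⋖ y := by simpa using hy
    exact hy.lt
  · intro C hC
    obtain ⟨hS, hch, hmax⟩ := mem_maxChainsIn.1 hC
    have hne : C.Nonempty := by
      by_contra hne
      rw [Finset.not_nonempty_iff_eq_empty] at hne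
      obtain ⟨x, hx⟩ := hp
      have := hmax x hx
      simp [hne] at this
    obtain ⟨y, hy⟩ := C.exists_minimal hne
    have hbot : ∀ c ∈ C, y ≤ c := fun c hc =>
      (hch y hy.prop c hc).elim id fun h => hy.le_of_le hc h
    refine ⟨y, ⟨?_, hy.prop⟩, ?_⟩
    · simp only [Finset.mem_filter, Finset.mem_univ, true_and]
      refine ⟨hS y hy.prop, fun z hpz hzy => ?_⟩
      exact hzy.not_ge (hbot z (hmax z hpz fun c hc => Or.inl (hzy.le.trans (hbot c hc))))
    · rintro z ⟨hz, hzC⟩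
      replace hz : p ⋖ z := by simpa using hz
      exact ((hbot z hzC).lt_or_eq.resolve_left fun h => hz.2 (hS y hy.prop) h).symm

end ChainWeight

section Rowmotion

variable {P : Type} [Fintype P] [PartialOrder P]

theorem aApplyB_pos {κ : ℝ} (hκ : 0 < κ) (rk : P → ℕ) {π : P → ℝ} (hπ : ∀ p, 0 < π p)
    (w : List ℕ) (p : P) : 0 < aApplyB κ rk w π p := by
  induction w generalizing p with
  | nil => exact hπ p
  | cons i w ih =>
    simp only [aApplyB, arankToggleB]
    split_ifs
    · rw [chainSum_eq_mul]
      exact div_pos hκ (mul_pos (ih p) (mul_pos (chainWeight_pos ih _) (chainWeight_pos ih _)))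
    · exact ih p

theorem RowAB_pos {κ : ℝ} (hκ : 0 < κ) (rk : P → ℕ) (r : ℕ) {π : P → ℝ} (hπ : ∀ p, 0 < π p)
    (p : P) : 0 < RowAB κ rk r π p :=
  aApplyB_pos hκ rk hπ (arowWordB r) p

theorem aApplyB_range_reverse_succ (κ : ℝ) (rk : P → ℕ) (π : P → ℝ) (t : ℕ) :
    aApplyB κ rk (List.range (t + 1)).reverse π =
      arankToggleB κ rk t (aApplyB κ rk (List.range t).reverse π) := by
  rw [List.range_succ, List.reverse_append]
  rfl

theorem aApplyB_range_reverse_of_le (κ : ℝ) (rk : P → ℕ) (π : P → ℝ) {t : ℕ} {p : P}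
    (h : t ≤ rk p) : aApplyB κ rk (List.range t).reverse π p = π p := by
  induction t with
  | zero => rfl
  | succ t ih =>
    rw [aApplyB_range_reverse_succ, arankToggleB, if_neg (by omega), ih (by omega)]

theorem aApplyB_range_reverse_of_lt (κ : ℝ) (rk : P → ℕ) (π : P → ℝ) {s t : ℕ} {p : P}
    (hs : rk p < s) (hst : s ≤ t) :
    aApplyB κ rk (List.range t).reverse π p = aApplyB κ rk (List.range s).reverse π p := by
  induction t, hst using Nat.le_induction with
  | base => rfl
  | succ t hst ih =>
    rw [aApplyB_range_reverse_succ, arankToggleB, if_neg (by omega), ih]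

/-- Rowmotion inverts, up to the factor `κ`, the weight of chains starting at `p` into the weight of
chains ending at `p`. -/
theorem RowAB_mul_chainWeight {κ : ℝ} (hκ : 0 < κ) {rk : P → ℕ} (hrk : StrictMono rk) {r : ℕ}
    {π : P → ℝ} (hπ : ∀ p, 0 < π p) {p : P} (hp : rk p ≤ r) :
    (RowAB κ rk r π p * chainWeight (RowAB κ rk r π) (Set.Iio p)) *
      (π p * chainWeight π (Set.Ioi p)) = κ := by
  set σ := aApplyB κ rk (List.range (rk p)).reverse π with hσ
  have hσpos : ∀ q, 0 < σ q := aApplyB_pos hκ rk hπ _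
  have hrow : RowAB κ rk r π = aApplyB κ rk (List.range (r + 1)).reverse π := rfl
  have h1 : RowAB κ rk r π p = κ / chainSum σ p := by
    rw [hrow, aApplyB_range_reverse_of_lt κ rk π (Nat.lt_succ_self (rk p)) (by omega),
      aApplyB_range_reverse_succ, arankToggleB, if_pos rfl]
  have h2 : chainWeight (RowAB κ rk r π) (Set.Iio p) = chainWeight σ (Set.Iio p) :=
    chainWeight_congr fun q hq => by
      rw [hrow, aApplyB_range_reverse_of_lt κ rk π (hrk hq) (by omega)]
  have h3 : chainWeight σ (Set.Ioi p) = chainWeight π (Set.Ioi p) :=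
    chainWeight_congr fun q hq => aApplyB_range_reverse_of_le κ rk π (hrk hq).le
  have h4 : σ p = π p := aApplyB_range_reverse_of_le κ rk π le_rfl
  have h5 := chainWeight_pos hσpos (Set.Iio p)
  have h6 := chainWeight_pos hπ (Set.Ioi p)
  have h7 := hπ p
  rw [h1, h2, chainSum_eq_mul, h3, h4]
  field_simp

end Rowmotion

section IntervalPoset

variable {n : ℕ}

/-- The element `[i,j]` of `Aⁿ`. -/
def AnP.interval (i j : ℕ) (h : 1 ≤ i ∧ i ≤ j ∧ j ≤ n) : AnP n := ⟨(i, j), h⟩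

@[simp]
theorem AnP.interval_val (i j : ℕ) (h : 1 ≤ i ∧ i ≤ j ∧ j ≤ n) :
    (AnP.interval i j h).val = (i, j) :=
  rfl

theorem AnP.ext {x y : AnP n} (h1 : x.val.1 = y.val.1) (h2 : x.val.2 = y.val.2) : x = y :=
  Subtype.ext (Prod.ext h1 h2)

theorem AnP.lt_iff (x y : AnP n) :
    x < y ↔ (y.val.1 ≤ x.val.1 ∧ x.val.2 ≤ y.val.2) ∧
      ¬ (x.val.1 = y.val.1 ∧ x.val.2 = y.val.2) := by
  rw [lt_iff_le_not_ge]
  change (y.val.1 ≤ x.val.1 ∧ x.val.2 ≤ y.val.2) ∧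
    ¬ (x.val.1 ≤ y.val.1 ∧ y.val.2 ≤ x.val.2) ↔ _
  omega

theorem AnP.covBy_iff (x y : AnP n) :
    x ⋖ y ↔ (x.val.1 = y.val.1 + 1 ∧ x.val.2 = y.val.2) ∨
      (x.val.1 = y.val.1 ∧ x.val.2 + 1 = y.val.2) := by
  have hx := x.property
  have hy := y.property
  simp only [CovBy, AnP.lt_iff]
  constructor
  · rintro ⟨h, hz⟩
    by_contra hne
    rcases Nat.lt_or_ge y.val.1 x.val.1 with hlt | hge
    · exact hz (c := AnP.interval (y.val.1 + 1) y.val.2 (by omega))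
        (by simp only [AnP.interval_val]; omega) (by simp only [AnP.interval_val]; omega)
    · exact hz (c := AnP.interval y.val.1 (y.val.2 - 1) (by omega))
        (by simp only [AnP.interval_val]; omega) (by simp only [AnP.interval_val]; omega)
  · intro h
    exact ⟨by omega, fun z => by omega⟩

theorem rkAn_strictMono (n : ℕ) : StrictMono (rkAn n) := by
  intro x y h
  have hx := x.property
  have hy := y.property
  rw [AnP.lt_iff] at h
  unfold rkAn
  omega

/-- The extension by zero of a function on `Aⁿ` to all pairs of natural numbers. -/
noncomputable def extendAn (φ : AnP n → ℝ) (i j : ℕ) : ℝ :=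
  if h : 1 ≤ i ∧ i ≤ j ∧ j ≤ n then φ (AnP.interval i j h) else 0

theorem extendAn_of_mem (φ : AnP n → ℝ) {i j : ℕ} (h : 1 ≤ i ∧ i ≤ j ∧ j ≤ n) :
    extendAn φ i j = φ (AnP.interval i j h) :=
  dif_pos h

theorem extendAn_pos {φ : AnP n → ℝ} (hφ : ∀ p, 0 < φ p) {i j : ℕ}
    (h : 1 ≤ i ∧ i ≤ j ∧ j ≤ n) : 0 < extendAn φ i j := by
  rw [extendAn_of_mem φ h]
  exact hφ _

theorem sum_ite_val_eq (φ : AnP n → ℝ) (i j : ℕ) :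
    ∑ y : AnP n, (if y.val.1 = i ∧ y.val.2 = j then φ y else 0) = extendAn φ i j := by
  unfold extendAn
  split_ifs with h
  · rw [Finset.sum_eq_single_of_mem (AnP.interval i j h) (Finset.mem_univ _), if_pos ⟨rfl, rfl⟩]
    exact fun y _ hy => if_neg fun h' => hy (AnP.ext h'.1 h'.2)
  · refine Finset.sum_eq_zero fun y _ => if_neg ?_
    rintro ⟨rfl, rfl⟩
    exact h y.property

theorem sum_covBy_below (φ : AnP n → ℝ) (p : AnP n) :
    ∑ y ∈ Finset.univ.filter (fun y => y ⋖ p), φ y =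
      extendAn φ (p.val.1 + 1) p.val.2 + extendAn φ p.val.1 (p.val.2 - 1) := by
  rw [Finset.sum_filter, ← sum_ite_val_eq, ← sum_ite_val_eq, ← Finset.sum_add_distrib]
  refine Finset.sum_congr rfl fun y _ => ?_
  have := p.property
  have h : y ⋖ p ↔ (y.val.1 = p.val.1 + 1 ∧ y.val.2 = p.val.2) ∨
      (y.val.1 = p.val.1 ∧ y.val.2 = p.val.2 - 1) := by
    rw [AnP.covBy_iff]
    omega
  simp only [h]
  split_ifs <;> first | omega | simp

theorem sum_covBy_above (φ : AnP n → ℝ) (p : AnP n) :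
    ∑ y ∈ Finset.univ.filter (fun y => p ⋖ y), φ y =
      extendAn φ (p.val.1 - 1) p.val.2 + extendAn φ p.val.1 (p.val.2 + 1) := by
  rw [Finset.sum_filter, ← sum_ite_val_eq, ← sum_ite_val_eq, ← Finset.sum_add_distrib]
  refine Finset.sum_congr rfl fun y _ => ?_
  have := p.property
  have := y.property
  have h : p ⋖ y ↔ (y.val.1 = p.val.1 - 1 ∧ y.val.2 = p.val.2) ∨
      (y.val.1 = p.val.1 ∧ y.val.2 = p.val.2 + 1) := by
    rw [AnP.covBy_iff]
    omega
  simp only [h]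
  split_ifs <;> first | omega | simp

/-- The total weight of the saturated chains from a minimal element of `Aⁿ` up to `[i,j]`. -/
noncomputable def weightUpTo (π : AnP n → ℝ) : ℕ → ℕ → ℝ :=
  extendAn fun p => π p * chainWeight π (Set.Iio p)

/-- The total weight of the saturated chains from `[i,j]` up to the maximum of `Aⁿ`. -/
noncomputable def weightFrom (π : AnP n → ℝ) : ℕ → ℕ → ℝ :=
  extendAn fun p => π p * chainWeight π (Set.Ioi p)

theorem weightUpTo_self (π : AnP n → ℝ) (i : ℕ) : weightUpTo π i i = extendAn π i i := by
  unfold weightUpTo extendAn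
  split_ifs with h
  · have : Set.Iio (AnP.interval i i h) = ∅ := by
      ext x
      have hx := x.property
      simp only [Set.mem_Iio, AnP.lt_iff, AnP.interval_val, Set.mem_empty_iff_false, iff_false]
      omega
    simp only [this, chainWeight_empty, mul_one]
  · rfl

theorem weightUpTo_of_lt (π : AnP n → ℝ) {i j : ℕ} (hi : 1 ≤ i) (hij : i < j) (hj : j ≤ n) :
    weightUpTo π i j =
      extendAn π i j * (weightUpTo π (i + 1) j + weightUpTo π i (j - 1)) := by
  have h : 1 ≤ i ∧ i ≤ j ∧ j ≤ n := ⟨hi, hij.le, hj⟩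
  have hne : (Set.Iio (AnP.interval i j h)).Nonempty :=
    ⟨AnP.interval i i (by omega), by
      simp only [Set.mem_Iio, AnP.lt_iff, AnP.interval_val]
      omega⟩
  have hs := chainWeight_Iio π hne
  rw [sum_covBy_below] at hs
  rw [weightUpTo, extendAn_of_mem _ h, extendAn_of_mem π h, hs]
  simp only [AnP.interval_val]

theorem weightFrom_one (π : AnP n → ℝ) : weightFrom π 1 n = extendAn π 1 n := by
  unfold weightFrom extendAn
  split_ifs with h
  · have : Set.Ioi (AnP.interval 1 n h) = ∅ := by
      ext x
      have hx := x.property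
      simp only [Set.mem_Ioi, AnP.lt_iff, AnP.interval_val, Set.mem_empty_iff_false, iff_false]
      omega
    simp only [this, chainWeight_empty, mul_one]
  · rfl

theorem weightFrom_of_ne (π : AnP n → ℝ) {i j : ℕ} (h : 1 ≤ i ∧ i ≤ j ∧ j ≤ n)
    (hne : ¬ (i = 1 ∧ j = n)) :
    weightFrom π i j =
      extendAn π i j * (weightFrom π (i - 1) j + weightFrom π i (j + 1)) := by
  have hne : (Set.Ioi (AnP.interval i j h)).Nonempty :=
    ⟨AnP.interval 1 n (by omega), by
      simp only [Set.mem_Ioi, AnP.lt_iff, AnP.interval_val]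
      omega⟩
  have hs := chainWeight_Ioi π hne
  rw [sum_covBy_above] at hs
  rw [weightFrom, extendAn_of_mem _ h, extendAn_of_mem π h, hs]
  simp only [AnP.interval_val]

theorem weightFrom_eq_zero (π : AnP n → ℝ) {i j : ℕ} (h : ¬ (1 ≤ i ∧ i ≤ j ∧ j ≤ n)) :
    weightFrom π i j = 0 :=
  dif_neg h

theorem weightUpTo_pos {π : AnP n → ℝ} (hπ : ∀ p, 0 < π p) {i j : ℕ}
    (h : 1 ≤ i ∧ i ≤ j ∧ j ≤ n) : 0 < weightUpTo π i j :=
  extendAn_pos (fun p => mul_pos (hπ p) (chainWeight_pos hπ _)) h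

theorem weightFrom_eq_div {κ : ℝ} (hκ : 0 < κ) {π : AnP n → ℝ} (hπ : ∀ p, 0 < π p) {i j : ℕ}
    (h : 1 ≤ i ∧ i ≤ j ∧ j ≤ n) :
    weightFrom π i j = κ / weightUpTo (RowAB κ (rkAn n) (n - 1) π) i j := by
  have hpos := weightUpTo_pos (RowAB_pos hκ (rkAn n) (n - 1) hπ) h
  rw [eq_div_iff hpos.ne', mul_comm]
  have hr : rkAn n (AnP.interval i j h) ≤ n - 1 := by
    simp only [rkAn, AnP.interval_val]
    omega
  have := RowAB_mul_chainWeight hκ (rkAn_strictMono n) hπ hr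
  rwa [weightFrom, weightUpTo, extendAn_of_mem _ h, extendAn_of_mem _ h]

theorem prod_ratio_identity {a b p q : ℕ → ℝ} {l : ℕ} (ha : ∀ k ≤ l + 1, 0 < a k)
    (hb : ∀ k ≤ l, 0 < b k) (hp0 : p 0 = a 0) (hp : ∀ k ≤ l, a (k + 1) = p (k + 1) * (a k + b k))
    (hq : ∀ k < l, q k * (b k * (a (k + 1) + b (k + 1))) = a (k + 1) * b (k + 1))
    (hql : q l * b l = a (l + 1)) :
    (∏ k ∈ Finset.range (l + 2), p k) * (a 0 + b 0) =
      a 0 * b 0 * ∏ k ∈ Finset.range (l + 1), q k := by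
  have key : ∀ t ≤ l, (∏ k ∈ Finset.range (t + 2), p k) * (a 0 + b 0) * b t =
      a 0 * b 0 * a (t + 1) * ∏ k ∈ Finset.range t, q k := by
    intro t
    induction t with
    | zero =>
      intro _
      simp only [Finset.prod_range_succ, Finset.prod_range_zero, hp0, zero_add]
      rw [hp 0 (by omega)]
      ring
    | succ t ih =>
      intro ht
      have ih := ih (by omega)
      have h1 := hp (t + 1) ht
      have h2 := hq t (by omega)
      have h3 := ha (t + 1) (by omega)
      have h4 := hb (t + 1) ht
      have h5 := hb t (by omega)
      rw [Finset.prod_range_succ p (t + 2), Finset.prod_range_succ q t, h1]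
      refine mul_right_cancel₀ (mul_pos h5 (add_pos h3 h4)).ne' ?_
      linear_combination (p (t + 2) * b (t + 1) * (a (t + 1) + b (t + 1))) * ih -
        (a 0 * b 0 * p (t + 2) * (a (t + 1) + b (t + 1)) * ∏ k ∈ Finset.range t, q k) * h2
  have hl := key l le_rfl
  rw [Finset.prod_range_succ q l]
  refine mul_right_cancel₀ (hb l le_rfl).ne' ?_
  rw [hl, ← hql]
  ring

/-- The product of the values of `π` at the intervals starting at `i`. -/
noncomputable def startProd (π : AnP n → ℝ) (i : ℕ) : ℝ :=
  ∏ k ∈ Finset.range (n + 1 - i), extendAn π i (i + k)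

/-- The product of the values of `π` at the intervals ending at `i`. -/
noncomputable def endProd (π : AnP n → ℝ) (i : ℕ) : ℝ :=
  ∏ k ∈ Finset.range i, extendAn π (i - k) i

theorem hB_eq_startProd_mul_endProd (π : AnP n → ℝ) {i : ℕ} (hi1 : 1 ≤ i) (hi2 : i ≤ n) :
    hB n i π = startProd π i * endProd π i := by
  unfold hB startProd endProd
  congr 1
  · refine Finset.prod_bij' (fun p _ => p.val.2 - i)
      (fun k hk => AnP.interval i (i + k) (by have := Finset.mem_range.1 hk; omega)) ?_ ?_ ?_ ?_ ?_
    · intro p hp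
      have := p.property
      simp only [Finset.mem_filter, Finset.mem_univ, true_and, Finset.mem_range] at hp ⊢
      omega
    · intro k hk
      simp
    · intro p hp
      have := p.property
      simp only [Finset.mem_filter, Finset.mem_univ, true_and] at hp
      exact AnP.ext hp.symm (by simp only [AnP.interval_val]; omega)
    · intro k hk
      simp
    · intro p hp
      have := p.property
      simp only [Finset.mem_filter, Finset.mem_univ, true_and] at hp
      rw [extendAn_of_mem π (by omega)]
      exact congrArg π (AnP.ext hp (by simp only [AnP.interval_val]; omega))
  · refine Finset.prod_bij' (fun p _ => i - p.val.1)
      (fun k hk => AnP.interval (i - k) i (by have := Finset.mem_range.1 hk; omega)) ?_ ?_ ?_ ?_ ?_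
    · intro p hp
      have := p.property
      simp only [Finset.mem_filter, Finset.mem_univ, true_and, Finset.mem_range] at hp ⊢
      omega
    · intro k hk
      simp
    · intro p hp
      have := p.property
      simp only [Finset.mem_filter, Finset.mem_univ, true_and] at hp
      exact AnP.ext (by simp only [AnP.interval_val]; omega) hp.symm
    · intro k hk
      have := Finset.mem_range.1 hk
      simp only [AnP.interval_val]
      omega
    · intro p hp
      have := p.property
      simp only [Finset.mem_filter, Finset.mem_univ, true_and] at hp
      rw [extendAn_of_mem π (by omega)]
      exact congrArg π (AnP.ext (by simp only [AnP.interval_val]; omega) hp)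

variable {κ : ℝ} {π : AnP n → ℝ}

theorem startProd_RowAB (hκ : 0 < κ) (hπ : ∀ p, 0 < π p) {i : ℕ} (hi1 : 1 ≤ i) (hi2 : i < n) :
    startProd (RowAB κ (rkAn n) (n - 1) π) i *
        (weightUpTo (RowAB κ (rkAn n) (n - 1) π) i i +
          weightUpTo (RowAB κ (rkAn n) (n - 1) π) (i + 1) (i + 1)) =
      weightUpTo (RowAB κ (rkAn n) (n - 1) π) i i *
        weightUpTo (RowAB κ (rkAn n) (n - 1) π) (i + 1) (i + 1) * startProd π (i + 1) := by
  set σ := RowAB κ (rkAn n) (n - 1) π with hσ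
  have hσpos : ∀ p, 0 < σ p := RowAB_pos hκ (rkAn n) (n - 1) hπ
  obtain ⟨l, hl⟩ : ∃ l, n = i + 1 + l := ⟨n - (i + 1), by omega⟩
  have ha : ∀ k ≤ l + 1, 0 < weightUpTo σ i (i + k) := fun k hk =>
    weightUpTo_pos hσpos (by omega)
  have hb : ∀ k ≤ l, 0 < weightUpTo σ (i + 1) (i + 1 + k) := fun k hk =>
    weightUpTo_pos hσpos (by omega)
  have key := prod_ratio_identity (a := fun k => weightUpTo σ i (i + k))
    (b := fun k => weightUpTo σ (i + 1) (i + 1 + k)) (p := fun k => extendAn σ i (i + k))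
    (q := fun k => extendAn π (i + 1) (i + 1 + k)) (l := l) ha hb
    (by simp only [add_zero, weightUpTo_self])
    (fun k hk => by
      have h := weightUpTo_of_lt σ hi1 (show i < i + (k + 1) by omega) (by omega)
      rw [show i + (k + 1) - 1 = i + k by omega] at h
      rw [h, show i + 1 + k = i + (k + 1) by omega]
      ring)
    (fun k hk => by
      have h := weightFrom_of_ne π (i := i + 1) (j := i + 1 + k) (by omega) (by omega)
      rw [weightFrom_eq_div hκ hπ (by omega), weightFrom_eq_div hκ hπ (by omega),
        weightFrom_eq_div hκ hπ (by omega), ← hσ, Nat.add_sub_cancel] at h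
      have h1 := ha (k + 1) (by omega)
      have h2 := hb (k + 1) (by omega)
      have h3 := hb k (by omega)
      rw [show i + (k + 1) = i + 1 + k by omega] at h1 ⊢
      rw [show i + 1 + (k + 1) = i + 1 + k + 1 by omega] at h2 ⊢
      field_simp at h
      linarith)
    (by
      have h := weightFrom_of_ne π (i := i + 1) (j := i + 1 + l) (by omega) (by omega)
      rw [weightFrom_eq_zero π (i := i + 1) (j := i + 1 + l + 1) (by omega),
        weightFrom_eq_div hκ hπ (by omega), weightFrom_eq_div hκ hπ (by omega), ← hσ,
        Nat.add_sub_cancel, add_zero] at h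
      have h1 := ha (l + 1) (by omega)
      have h3 := hb l le_rfl
      rw [show i + (l + 1) = i + 1 + l by omega] at h1 ⊢
      field_simp at h
      linarith)
  have e1 : n + 1 - i = l + 2 := by omega
  have e2 : n + 1 - (i + 1) = l + 1 := by omega
  unfold startProd
  rw [e1, e2]
  simpa using key

theorem endProd_RowAB (hκ : 0 < κ) (hπ : ∀ p, 0 < π p) {i : ℕ} (hi1 : 1 ≤ i) (hi2 : i < n) :
    endProd (RowAB κ (rkAn n) (n - 1) π) (i + 1) *
        (weightUpTo (RowAB κ (rkAn n) (n - 1) π) i i +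
          weightUpTo (RowAB κ (rkAn n) (n - 1) π) (i + 1) (i + 1)) =
      weightUpTo (RowAB κ (rkAn n) (n - 1) π) i i *
        weightUpTo (RowAB κ (rkAn n) (n - 1) π) (i + 1) (i + 1) * endProd π i := by
  set σ := RowAB κ (rkAn n) (n - 1) π with hσ
  have hσpos : ∀ p, 0 < σ p := RowAB_pos hκ (rkAn n) (n - 1) hπ
  obtain ⟨l, rfl⟩ : ∃ l, i = l + 1 := ⟨i - 1, by omega⟩
  have ha : ∀ k ≤ l + 1, 0 < weightUpTo σ (l + 1 + 1 - k) (l + 1 + 1) := fun k hk =>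
    weightUpTo_pos hσpos (by omega)
  have hb : ∀ k ≤ l, 0 < weightUpTo σ (l + 1 - k) (l + 1) := fun k hk =>
    weightUpTo_pos hσpos (by omega)
  have key := prod_ratio_identity (a := fun k => weightUpTo σ (l + 1 + 1 - k) (l + 1 + 1))
    (b := fun k => weightUpTo σ (l + 1 - k) (l + 1))
    (p := fun k => extendAn σ (l + 1 + 1 - k) (l + 1 + 1))
    (q := fun k => extendAn π (l + 1 - k) (l + 1)) (l := l) ha hb
    (by simp only [Nat.sub_zero, weightUpTo_self])
    (fun k hk => by
      have h := weightUpTo_of_lt σ (i := l + 1 - k) (j := l + 1 + 1) (by omega) (by omega)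
        (by omega)
      rw [show l + 1 + 1 - (k + 1) = l + 1 - k by omega, h,
        show l + 1 - k + 1 = l + 1 + 1 - k by omega, Nat.add_sub_cancel])
    (fun k hk => by
      have h := weightFrom_of_ne π (i := l + 1 - k) (j := l + 1) (by omega) (by omega)
      rw [weightFrom_eq_div hκ hπ (by omega), weightFrom_eq_div hκ hπ (by omega),
        weightFrom_eq_div hκ hπ (by omega), ← hσ] at h
      have h1 := ha (k + 1) (by omega)
      have h2 := hb (k + 1) (by omega)
      have h3 := hb k (by omega)
      rw [show l + 1 + 1 - (k + 1) = l + 1 - k by omega] at h1 ⊢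
      rw [show l + 1 - (k + 1) = l + 1 - k - 1 by omega] at h2 ⊢
      field_simp at h
      linarith)
    (by
      have h := weightFrom_of_ne π (i := l + 1 - l) (j := l + 1) (by omega) (by omega)
      rw [weightFrom_eq_zero π (i := l + 1 - l - 1) (j := l + 1) (by omega),
        weightFrom_eq_div hκ hπ (by omega), weightFrom_eq_div hκ hπ (by omega), ← hσ,
        zero_add] at h
      have h1 := ha (l + 1) (by omega)
      have h3 := hb l le_rfl
      rw [show l + 1 + 1 - (l + 1) = l + 1 - l by omega] at h1 ⊢
      field_simp at h
      linarith)
  unfold endProd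
  simp only [Nat.sub_zero] at key
  rw [add_comm (weightUpTo σ (l + 1) (l + 1)), mul_comm (weightUpTo σ (l + 1) (l + 1))]
  exact key

theorem startProd_mul_endProd_RowAB (hκ : 0 < κ) (hπ : ∀ p, 0 < π p) {i : ℕ} (hi1 : 1 ≤ i)
    (hi2 : i < n) :
    startProd (RowAB κ (rkAn n) (n - 1) π) i * endProd π i =
      startProd π (i + 1) * endProd (RowAB κ (rkAn n) (n - 1) π) (i + 1) := by
  have hs := startProd_RowAB hκ hπ hi1 hi2
  have he := endProd_RowAB hκ hπ hi1 hi2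
  have hσpos := RowAB_pos hκ (rkAn n) (n - 1) hπ
  have h1 := weightUpTo_pos hσpos (i := i) (j := i) (by omega)
  have h2 := weightUpTo_pos hσpos (i := i + 1) (j := i + 1) (by omega)
  refine mul_right_cancel₀ (mul_pos h1 h2).ne' ?_
  linear_combination endProd (RowAB κ (rkAn n) (n - 1) π) (i + 1) * hs -
    startProd (RowAB κ (rkAn n) (n - 1) π) i * he

theorem endProd_last (π : AnP n → ℝ) (hn : 1 ≤ n) : endProd π n = weightFrom π n n := by
  have key : ∀ t < n, ∏ k ∈ Finset.range (t + 1), extendAn π (t + 1 - k) n =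
      weightFrom π (t + 1) n := by
    intro t
    induction t with
    | zero =>
      intro _
      simp [weightFrom_one]
    | succ t ih =>
      intro ht
      have h := weightFrom_of_ne π (i := t + 1 + 1) (j := n) (by omega) (by omega)
      rw [weightFrom_eq_zero π (i := t + 1 + 1) (j := n + 1) (by omega), add_zero,
        Nat.add_sub_cancel] at h
      rw [Finset.prod_range_succ', h, ← ih (by omega), mul_comm, Nat.sub_zero]
      congr 1
      exact Finset.prod_congr rfl fun k _ => by rw [Nat.add_sub_add_right]
  have h := key (n - 1) (by omega)
  rwa [Nat.sub_add_cancel hn] at h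

theorem startProd_mul_endProd_last (hκ : 0 < κ) (hπ : ∀ p, 0 < π p) (hn : 1 ≤ n) :
    startProd (RowAB κ (rkAn n) (n - 1) π) n * endProd π n = κ := by
  have hpos := weightUpTo_pos (RowAB_pos hκ (rkAn n) (n - 1) hπ)
    (i := n) (j := n) (by omega)
  have hs : startProd (RowAB κ (rkAn n) (n - 1) π) n =
      weightUpTo (RowAB κ (rkAn n) (n - 1) π) n n := by
    rw [startProd, Nat.add_sub_cancel_left, weightUpTo_self]
    simp
  rw [endProd_last π hn, hs, weightFrom_eq_div hκ hπ (by omega)]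
  field_simp

theorem prod_range_iterate_succ {α : Type*} (f : α → α) (φ : α → ℝ) {m : ℕ} {x : α}
    (hx : f^[m] x = x) :
    ∏ k ∈ Finset.range m, φ (f^[k + 1] x) = ∏ k ∈ Finset.range m, φ (f^[k] x) := by
  cases m with
  | zero => rfl
  | succ m =>
    rw [Finset.prod_range_succ, Finset.prod_range_succ', hx]
    rfl

theorem RowAB_iterate_pos (hκ : 0 < κ) (hπ : ∀ p, 0 < π p) (k : ℕ) (p : AnP n) :
    0 < (RowAB κ (rkAn n) (n - 1))^[k] π p := by
  induction k generalizing p with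
  | zero => exact hπ p
  | succ k ih =>
    rw [Function.iterate_succ_apply']
    exact RowAB_pos hκ (rkAn n) (n - 1) ih p

end IntervalPoset

/-- For every `n ≥ 1`, `κ > 0` and `1 ≤ i ≤ n`, the statistic `h^B_i`
is multiplicatively `κ`-mesic for birational antichain rowmotion of `Aⁿ`: for every
`π : Aⁿ → ℝ>0` and every `m ≥ 1` with `(Row^B_A)^m(π) = π`, one has
`∏_{k=0}^{m-1} h^B_i((Row^B_A)^k π) = κ^m`. -/
theorem stmt15 (n : ℕ) (hn : 1 ≤ n) (κ : ℝ) (hκ : 0 < κ)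
    (i : ℕ) (hi1 : 1 ≤ i) (hi2 : i ≤ n)
    (π : AnP n → ℝ) (hpos : ∀ p, 0 < π p)
    (m : ℕ) (hm : 1 ≤ m) (hfix : (RowAB κ (rkAn n) (n - 1))^[m] π = π) :
    ∏ k ∈ Finset.range m, hB n i ((RowAB κ (rkAn n) (n - 1))^[k] π) = κ ^ m := by
  set R := RowAB κ (rkAn n) (n - 1)
  have hk : ∀ k p, 0 < R^[k] π p := RowAB_iterate_pos hκ hpos
  induction hi2 using Nat.decreasingInduction with
  | self =>
    simp_rw [hB_eq_startProd_mul_endProd _ hn le_rfl]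
    rw [Finset.prod_mul_distrib, ← prod_range_iterate_succ R (startProd · n) hfix,
      ← Finset.prod_mul_distrib]
    simp_rw [Function.iterate_succ_apply']
    rw [Finset.prod_congr rfl fun k _ => startProd_mul_endProd_last hκ (hk k) hn]
    simp
  | of_succ i hi ih =>
    rw [← ih (by omega)]
    simp_rw [hB_eq_startProd_mul_endProd _ hi1 hi.le,
      hB_eq_startProd_mul_endProd _ (Nat.le_add_left 1 i) hi]
    rw [Finset.prod_mul_distrib, Finset.prod_mul_distrib,
      ← prod_range_iterate_succ R (startProd · i) hfix,
      ← prod_range_iterate_succ R (endProd · (i + 1)) hfix,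
      ← Finset.prod_mul_distrib, ← Finset.prod_mul_distrib]
    refine Finset.prod_congr rfl fun k _ => ?_
    simp_rw [Function.iterate_succ_apply']
    exact startProd_mul_endProd_RowAB hκ (hk k) hi1 hi
end
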